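/- (Convergence rate of Anderson acceleration with optimized damping, AAoptD(m).) Let g : ℝ^n → ℝ^n be a κ-contraction with fixed point x*, and suppose g has an L-Lipschitz derivative on B(x*, ρ). Fix an integer m ≥ 1 and reals M ≥ 1, ε > 0. Then there exists C > 0 depending only on κ, L, m and M such that the following holds for every k > m. Suppose x_{k−m}, …, x_k ∈ B(x*, ρ) with f(x_k) ≠ 0; suppose α^{(k)} = (α_0^{(k)}, …, α_m^{(k)}) solves min ‖Σ_{i=0}^m α_i f(x_{k−m+i})‖ subject to Σ_{i=0}^m α_i = 1, and that Σ_{i=0}^{m−1} |α_i^{(k)}| < M and |α_m^{(k)}| ≥ ε; suppose the combinations x_k^α := Σ_{i=0}^m α_i^{(k)} x_{k−m+i} and x̃_k^α := Σ_{i=0}^m α_i^{(k)} g(x_{k−m+i}) lie in B(x*, ρ); let β_k ∈ [0,1] and set x_{k+1} := x_k^α + β_k (x̃_k^α − x_k^α). Define the gain θ_{k+1} := ‖Σ_{i=0}^m α_i^{(k)} f(x_{k−m+i})‖ / ‖f(x_k)‖. Then 0 ≤ θ_{k+1} ≤ 1 and ‖f(x_{k+1})‖ ≤ θ_{k+1}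 ((1 − β_k) + κ β_k) ‖f(x_k)‖ + C · Σ_{i=0}^m ‖f(x_{k−m+i})‖². -/

import Mathlib

section AffineCombinations

variable {E : Type*} [NormedAddCommGroup E] [NormedSpace ℝ E]

/-- First-order Taylor bound at the centre of a ball on which the derivative is Lipschitz. -/
lemma norm_sub_sub_fderiv_le_of_lipschitz {g : E → E} {g' : E → E →L[ℝ] E} {c y : E} {ρ L : ℝ}
    (hL : 0 ≤ L) (hg : ∀ x ∈ Metric.closedBall c ρ, HasFDerivAt g (g' x) x)
    (hlip : ∀ x ∈ Metric.closedBall c ρ, ‖g' x - g' c‖ ≤ L * ‖x - c‖)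
    (hy : y ∈ Metric.closedBall c ρ) :
    ‖g y - g c - g' c (y - c)‖ ≤ L * ‖y - c‖ ^ 2 := by
  have hsub : Metric.closedBall c ‖y - c‖ ⊆ Metric.closedBall c ρ :=
    Metric.closedBall_subset_closedBall (mem_closedBall_iff_norm.1 hy)
  have h := (convex_closedBall c ‖y - c‖).norm_image_sub_le_of_norm_hasFDerivWithin_le'
    (f := g) (f' := g') (φ := g' c) (C := L * ‖y - c‖) (x := c) (y := y)
    (fun x hx => (hg x (hsub hx)).hasFDerivWithinAt)
    (fun x hx => (hlip x (hsub hx)).trans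
      (mul_le_mul_of_nonneg_left (mem_closedBall_iff_norm.1 hx) hL))
    (Metric.mem_closedBall_self (norm_nonneg _)) (mem_closedBall_iff_norm.2 le_rfl)
  calc _ ≤ L * ‖y - c‖ * ‖y - c‖ := h
    _ = L * ‖y - c‖ ^ 2 := by ring

/-- The squared norm of a linear combination is controlled by the squared norms of its terms. -/
lemma norm_sum_smul_sq_le {ι : Type*} [Fintype ι] {a : ι → ℝ} {A : ℝ}
    (hA : ∑ i, |a i| ≤ A) (v : ι → E) :
    ‖∑ i, a i • v i‖ ^ 2 ≤ A ^ 2 * ∑ i, ‖v i‖ ^ 2 := by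
  have hA0 : 0 ≤ A := (Finset.sum_nonneg fun i _ => abs_nonneg (a i)).trans hA
  have h1 : ‖∑ i, a i • v i‖ ≤ ∑ i, |a i| * ‖v i‖ :=
    (norm_sum_le _ _).trans_eq (by simp [norm_smul])
  have h2 : (∑ i, |a i| * ‖v i‖) ^ 2 ≤ (∑ i, |a i| ^ 2) * ∑ i, ‖v i‖ ^ 2 :=
    Finset.sum_mul_sq_le_sq_mul_sq _ _ _
  have h3 : ∑ i, |a i| ^ 2 ≤ A ^ 2 :=
    (Finset.sum_sq_le_sq_sum_of_nonneg fun i _ => abs_nonneg (a i)).trans (by gcongr)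
  calc _ ≤ (∑ i, |a i| * ‖v i‖) ^ 2 := by gcongr
    _ ≤ _ := h2
    _ ≤ _ := by gcongr

/-- A map with quadratic Taylor remainder at `c` almost commutes with affine combinations. -/
lemma norm_map_affineCombination_sub_le {ι : Type*} [Fintype ι] {g : E → E} {T : E →L[ℝ] E}
    {c : E} {L A : ℝ} {a : ι → ℝ} {y : ι → E} (hL : 0 ≤ L)
    (hy : ∀ i, ‖g (y i) - g c - T (y i - c)‖ ≤ L * ‖y i - c‖ ^ 2)
    (hz : ‖g (∑ i, a i • y i) - g c - T (∑ i, a i • y i - c)‖ ≤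
      L * ‖∑ i, a i • y i - c‖ ^ 2)
    (ha : ∑ i, a i = 1) (hA : ∑ i, |a i| ≤ A) :
    ‖g (∑ i, a i • y i) - ∑ i, a i • g (y i)‖ ≤ L * (A ^ 2 + A) * ∑ i, ‖y i - c‖ ^ 2 := by
  have hcomb (v : ι → E) (w : E) : ∑ i, a i • v i - w = ∑ i, a i • (v i - w) := by
    simp [smul_sub, ← Finset.sum_smul, ha]
  have hrem : g (∑ i, a i • y i) - ∑ i, a i • g (y i) =
      (g (∑ i, a i • y i) - g c - T (∑ i, a i • y i - c)) -
        ∑ i, a i • (g (y i) - g c - T (y i - c)) := by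
    have h := hcomb (fun i => g (y i)) (g c)
    simp only [hcomb y c, map_sum, map_smul, smul_sub _ (g _ - g c), Finset.sum_sub_distrib, ← h]
    abel
  have hS : ‖∑ i, a i • (g (y i) - g c - T (y i - c))‖ ≤ A * (L * ∑ i, ‖y i - c‖ ^ 2) := by
    calc _ ≤ ∑ i, |a i| * (L * ∑ j, ‖y j - c‖ ^ 2) := by
          refine norm_sum_le_of_le _ fun i _ => ?_
          rw [norm_smul, Real.norm_eq_abs]
          gcongr
          refine (hy i).trans ?_
          gcongr
          exact Finset.single_le_sum (f := fun j => ‖y j - c‖ ^ 2)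
            (fun j _ => sq_nonneg _) (Finset.mem_univ i)
      _ ≤ _ := by
          rw [← Finset.sum_mul]
          gcongr
  have hZ := norm_sum_smul_sq_le hA fun i => y i - c
  rw [hcomb y c] at hz
  rw [hrem, hcomb y c]
  calc _ ≤ L * (A ^ 2 * ∑ i, ‖y i - c‖ ^ 2) + A * (L * ∑ i, ‖y i - c‖ ^ 2) :=
        (norm_sub_le _ _).trans (add_le_add (hz.trans (by gcongr)) hS)
    _ = _ := by ring

/-- Residual bound for a damped step from `z` towards `w`. -/
lemma norm_residual_damped_le {g : E → E} {κ β : ℝ} (hg : ∀ x y, ‖g y - g x‖ ≤ κ * ‖y - x‖)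
    (hβ0 : 0 ≤ β) (hβ1 : β ≤ 1) (z w : E) :
    ‖g (z + β • (w - z)) - (z + β • (w - z))‖ ≤
      ((1 - β) + κ * β) * ‖w - z‖ + ‖g z - w‖ := by
  have h : g (z + β • (w - z)) - (z + β • (w - z)) =
      (g (z + β • (w - z)) - g z) + (1 - β) • (w - z) + (g z - w) := by
    rw [sub_smul, one_smul]
    abel
  have h1 : ‖g (z + β • (w - z)) - g z‖ ≤ κ * (β * ‖w - z‖) := by
    simpa [norm_smul, abs_of_nonneg hβ0] using hg z (z + β • (w - z))
  have h2 : ‖(1 - β) • (w - z)‖ = (1 - β) * ‖w - z‖ := by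
    rw [norm_smul, Real.norm_of_nonneg (sub_nonneg.2 hβ1)]
  rw [h]
  linarith [norm_add₃_le (a := g (z + β • (w - z)) - g z) (b := (1 - β) • (w - z))
    (c := g z - w)]

end AffineCombinations

/-- The distance to the fixed point of a contraction is controlled by the residual. -/
lemma one_sub_mul_norm_sub_fixedPoint_le {E : Type*} [NormedAddCommGroup E] {g : E → E}
    {κ : ℝ} {c y : E} (hc : g c = c) (hg : ‖g y - g c‖ ≤ κ * ‖y - c‖) :
    (1 - κ) * ‖y - c‖ ≤ ‖g y - y‖ := by
  have h : y - c = (g y - g c) - (g y - y) := by rw [hc]; abel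
  have := norm_sub_le (g y - g c) (g y - y)
  rw [← h] at this
  linarith

/-- Convergence rate of Anderson acceleration with optimized damping
`AAoptD(m)`.  For a κ-contraction `g` with fixed point `xstar` whose derivative is
`L`-Lipschitz on `B(xstar, ρ)`, there is `C > 0` depending only on `κ, L, m, M` such that
for every `ε > 0` and `k > m`: if `x (k-m), …, x k ∈ B(xstar, ρ)` with `f (x k) ≠ 0`,
the coefficients `α` solve the constrained minimization of `‖∑ α i • f (x (k-m+i))‖`
subject to `∑ α i = 1`, with `∑_{i<m} |α i| < M` and `|α m| ≥ ε`, the combinations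
`x^α` and `x̃^α` lie in the ball, and `β ∈ [0,1]`, then the gain
`θ = ‖∑ α i • f (x (k-m+i))‖ / ‖f (x k)‖` satisfies `0 ≤ θ ≤ 1` and the next iterate
`x_{k+1} = x^α + β • (x̃^α - x^α)` satisfies
`‖f x_{k+1}‖ ≤ θ ((1-β) + κ β) ‖f (x k)‖ + C ∑ ‖f (x (k-m+i))‖²`, where `f x = g x - x`. -/
theorem AAoptD_convergence_rate
    (κ L M : ℝ) (m : ℕ) (hm : 1 ≤ m)
    (hκ0 : 0 < κ) (hκ1 : κ < 1) (hL : 0 ≤ L) (hM : 1 ≤ M) :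
    ∃ C > 0, ∀ (ε : ℝ), 0 < ε → ∀ (n : ℕ)
      (g : EuclideanSpace ℝ (Fin n) → EuclideanSpace ℝ (Fin n))
      (g' : EuclideanSpace ℝ (Fin n) →
        (EuclideanSpace ℝ (Fin n) →L[ℝ] EuclideanSpace ℝ (Fin n)))
      (xstar : EuclideanSpace ℝ (Fin n)) (ρ : ℝ),
      g xstar = xstar →
      (∀ x y, ‖g y - g x‖ ≤ κ * ‖y - x‖) →
      (∀ x ∈ Metric.closedBall xstar ρ, HasFDerivAt g (g' x) x) →
      (∀ x ∈ Metric.closedBall xstar ρ, ∀ y ∈ Metric.closedBall xstar ρ,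
        ‖g' x - g' y‖ ≤ L * ‖x - y‖) →
      ∀ (k : ℕ), m < k →
      ∀ (x : ℕ → EuclideanSpace ℝ (Fin n)) (α : Fin (m + 1) → ℝ),
        (∀ i : Fin (m + 1), x (k - m + (i : ℕ)) ∈ Metric.closedBall xstar ρ) →
        g (x k) - x k ≠ 0 →
        (∑ i, α i) = 1 →
        (∀ α' : Fin (m + 1) → ℝ, (∑ i, α' i) = 1 →
          ‖∑ i, α i • (g (x (k - m + (i : ℕ))) - x (k - m + (i : ℕ)))‖ ≤
          ‖∑ i, α' i • (g (x (k - m + (i : ℕ))) - x (k - m + (i : ℕ)))‖) →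
        (∑ i : Fin m, |α i.castSucc|) < M →
        ε ≤ |α (Fin.last m)| →
        (∑ i, α i • x (k - m + (i : ℕ))) ∈ Metric.closedBall xstar ρ →
        (∑ i, α i • g (x (k - m + (i : ℕ)))) ∈ Metric.closedBall xstar ρ →
        ∀ β : ℝ, 0 ≤ β → β ≤ 1 →
          (0 ≤ ‖∑ i, α i • (g (x (k - m + (i : ℕ))) - x (k - m + (i : ℕ)))‖ /
                ‖g (x k) - x k‖ ∧
           ‖∑ i, α i • (g (x (k - m + (i : ℕ))) - x (k - m + (i : ℕ)))‖ /
                ‖g (x k) - x k‖ ≤ 1 ∧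
           ‖g ((∑ i, α i • x (k - m + (i : ℕ))) +
                  β • ((∑ i, α i • g (x (k - m + (i : ℕ)))) -
                       (∑ i, α i • x (k - m + (i : ℕ))))) -
              ((∑ i, α i • x (k - m + (i : ℕ))) +
                  β • ((∑ i, α i • g (x (k - m + (i : ℕ)))) -
                       (∑ i, α i • x (k - m + (i : ℕ)))))‖ ≤
             (‖∑ i, α i • (g (x (k - m + (i : ℕ))) - x (k - m + (i : ℕ)))‖ /
                ‖g (x k) - x k‖) * ((1 - β) + κ * β) * ‖g (x k) - x k‖ +
             C * ∑ i : Fin (m + 1),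
                ‖g (x (k - m + (i : ℕ))) - x (k - m + (i : ℕ))‖ ^ 2) := by
  have hκ : 0 < 1 - κ := sub_pos.2 hκ1
  set A : ℝ := 2 * M + 1 with hAdef
  have hA0 : 0 ≤ A := by linarith
  refine ⟨L * (A ^ 2 + A) / (1 - κ) ^ 2 + 1, by positivity, ?_⟩
  intro ε _ n g g' xstar ρ hfix hcontr hderiv hlip k hk x α hx hfk hα hmin hαM _ hxα _ β hβ0 hβ1
  have hfk' : 0 < ‖g (x k) - x k‖ := norm_pos_iff.2 hfk
  have hgain : ‖∑ i, α i • (g (x (k - m + (i : ℕ))) - x (k - m + (i : ℕ)))‖ ≤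
      ‖g (x k) - x k‖ := by
    simpa [Pi.single_apply, ite_smul, Nat.sub_add_cancel hk.le] using
      hmin (Pi.single (Fin.last m) 1) (by simp)
  refine ⟨by positivity, (div_le_one hfk').2 hgain, ?_⟩
  have hαA : ∑ i, |α i| ≤ A := by
    rw [Fin.sum_univ_castSucc] at hα ⊢
    have hlast : |α (Fin.last m)| ≤ 1 + M := by
      rw [eq_sub_of_add_eq' hα]
      refine (abs_sub _ _).trans ?_
      have := Finset.abs_sum_le_sum_abs (fun i : Fin m => α i.castSucc) Finset.univ
      rw [abs_one]
      linarith
    linarith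
  have hcentre : xstar ∈ Metric.closedBall xstar ρ :=
    Metric.mem_closedBall_self (dist_nonneg.trans (hx 0))
  have htaylor (y) (hy : y ∈ Metric.closedBall xstar ρ) :=
    norm_sub_sub_fderiv_le_of_lipschitz hL hderiv (fun z hz => hlip z hz xstar hcentre) hy
  have hcomb := norm_map_affineCombination_sub_le hL (fun i => htaylor _ (hx i))
    (htaylor _ hxα) hα hαA
  have herr : ∑ i : Fin (m + 1), ‖x (k - m + (i : ℕ)) - xstar‖ ^ 2 ≤
      (∑ i : Fin (m + 1), ‖g (x (k - m + (i : ℕ))) - x (k - m + (i : ℕ))‖ ^ 2) /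
        (1 - κ) ^ 2 := by
    rw [le_div_iff₀' (by positivity), Finset.mul_sum]
    refine Finset.sum_le_sum fun i _ => ?_
    rw [← mul_pow]
    gcongr
    exact one_sub_mul_norm_sub_fixedPoint_le hfix (hcontr _ _)
  have hbound := hcomb.trans (mul_le_mul_of_nonneg_left herr (by positivity))
  have hstep := norm_residual_damped_le hcontr hβ0 hβ1
    (∑ i, α i • x (k - m + (i : ℕ))) (∑ i, α i • g (x (k - m + (i : ℕ))))
  have hres : ∑ i, α i • (g (x (k - m + (i : ℕ))) - x (k - m + (i : ℕ))) =
      ∑ i, α i • g (x (k - m + (i : ℕ))) - ∑ i, α i • x (k - m + (i : ℕ)) := by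
    simp [smul_sub]
  refine hstep.trans (add_le_add (le_of_eq ?_) (hbound.trans ?_))
  · rw [mul_right_comm, div_mul_cancel₀ _ hfk'.ne', mul_comm, hres]
  · rw [← mul_div_assoc, ← div_mul_eq_mul_div]
    exact mul_le_mul_of_nonneg_right (le_add_of_nonneg_right zero_le_one)
      (Finset.sum_nonneg fun i _ => sq_nonneg _)
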